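/- arXiv:2512.07529 — 2 statements merged into one kernel-verified Lean document; each statement's English description precedes it below -/
import Mathlib

section
/- For every m ∈ ℕ and all smooth functions f, g, h : ℝ^{2m+1} → ℝ, the standard Jacobi bracket {f,g}(x) = Σ_{i=1}^{m} [(x_{m+i} ∂₀f(x) − ∂ᵢf(x)) ∂_{m+i}g(x) − (x_{m+i} ∂₀g(x) − ∂ᵢg(x)) ∂_{m+i}f(x)] + f(x) ∂₀g(x) − g(x) ∂₀f(x) is antisymmetric, {g,f} = −{f,g}, and satisfies the Jacobi identity {f,{g,h}} + {g,{h,f}} + {h,{f,g}} = 0. -/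
/-- The partial derivative in the `i`-th coordinate of `f : ℝⁿ → ℝ`. -/
noncomputable def pd {n : ℕ} (f : (Fin n → ℝ) → ℝ) (i : Fin n) (x : Fin n → ℝ) : ℝ :=
  fderiv ℝ f x (Pi.single i 1)

/-- The standard Jacobi bracket on `ℝ^(2m+1)` with coordinates `(x₀, x₁, …, x_{2m})`:
`{f,g}(x) = Σ_{i=1}^m [(x_{m+i} ∂₀f − ∂ᵢf) ∂_{m+i}g − (x_{m+i} ∂₀g − ∂ᵢg) ∂_{m+i}f]
            + f ∂₀g − g ∂₀f`. -/
noncomputable def stdJacobiBracket (m : ℕ) (f g : (Fin (2 * m + 1) → ℝ) → ℝ) :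
    (Fin (2 * m + 1) → ℝ) → ℝ :=
  fun x =>
    (∑ i : Fin m,
      ((x ⟨m + 1 + i.val, by have := i.isLt; omega⟩ * pd f ⟨0, by omega⟩ x
            - pd f ⟨i.val + 1, by have := i.isLt; omega⟩ x)
          * pd g ⟨m + 1 + i.val, by have := i.isLt; omega⟩ x
        - (x ⟨m + 1 + i.val, by have := i.isLt; omega⟩ * pd g ⟨0, by omega⟩ x
            - pd g ⟨i.val + 1, by have := i.isLt; omega⟩ x)
          * pd f ⟨m + 1 + i.val, by have := i.isLt; omega⟩ x))
    + f x * pd g ⟨0, by omega⟩ x - g x * pd f ⟨0, by omega⟩ x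

/-- The bracket `∑ᵢ (Aᵢ f · Bᵢ g - Aᵢ g · Bᵢ f) + f · E g - g · E f` on a commutative algebra,
built from derivations `A`, `B` and `E`. -/
def derivationBracket {𝕜 R ι : Type*} [Field 𝕜] [CommRing R] [Algebra 𝕜 R] [Fintype ι]
    (A B : ι → Derivation 𝕜 R R) (E : Derivation 𝕜 R R) (f g : R) : R :=
  ∑ i, (A i f * B i g - A i g * B i f) + f * E g - g * E f

theorem derivationBracket_derivationBracket {𝕜 R ι : Type*} [Field 𝕜] [CommRing R] [Algebra 𝕜 R]
    [Fintype ι] (A B : ι → Derivation 𝕜 R R) (E : Derivation 𝕜 R R) (f g h : R) :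
    derivationBracket A B E f (derivationBracket A B E g h) =
      ∑ i, ∑ j, (A i f * B i (A j g * B j h - A j h * B j g)
          - A i (A j g * B j h - A j h * B j g) * B i f)
        + ∑ i, (A i f * B i (g * E h - h * E g) - A i (g * E h - h * E g) * B i f
          + f * E (A i g * B i h - A i h * B i g) - (A i g * B i h - A i h * B i g) * E f)
        + (f * E (g * E h - h * E g) - (g * E h - h * E g) * E f) := by
  have hK : derivationBracket A B E g h
      = ∑ j, (A j g * B j h - A j h * B j g) + (g * E h - h * E g) := by
    rw [derivationBracket, add_sub_assoc]
  rw [derivationBracket, hK]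
  generalize g * E h - h * E g = w
  obtain ⟨v, hv⟩ : ∃ v : ι → R, ∀ j, A j g * B j h - A j h * B j g = v j := ⟨_, fun _ => rfl⟩
  simp only [hv, map_add, map_sum, mul_add, add_mul, Finset.sum_add_distrib, Finset.sum_sub_distrib,
    Finset.mul_sum, Finset.sum_mul]
  ring

/-- The Jacobi identity holds when the derivations satisfy the Heisenberg commutation relations. -/
theorem derivationBracket_jacobi {𝕜 R ι : Type*} [Field 𝕜] [CharZero 𝕜] [CommRing R] [Algebra 𝕜 R]
    [Fintype ι] [DecidableEq ι] (A B : ι → Derivation 𝕜 R R) (E : Derivation 𝕜 R R)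
    (hAA : ∀ i j f, A i (A j f) = A j (A i f)) (hBB : ∀ i j f, B i (B j f) = B j (B i f))
    (hAB : ∀ i j f, A i (B j f) = B j (A i f) - if i = j then E f else 0)
    (hEA : ∀ i f, E (A i f) = A i (E f)) (hEB : ∀ i f, E (B i f) = B i (E f)) (f g h : R) :
    derivationBracket A B E f (derivationBracket A B E g h)
      + derivationBracket A B E g (derivationBracket A B E h f)
      + derivationBracket A B E h (derivationBracket A B E f g) = 0 := by
  let T (i j : ι) (f g h : R) : R :=
    A i f * (B i (A j g) * B j h + A j g * B i (B j h) - B i (A j h) * B j g - A j h * B i (B j g))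
      - (A i (A j g) * B j h + A j g * B j (A i h) - A i (A j h) * B j g - A j h * B j (A i g))
        * B i f
  let G (i : ι) (f g h : R) : R :=
    A i f * B i (g * E h - h * E g) - A i (g * E h - h * E g) * B i f
      + f * E (A i g * B i h - A i h * B i g) - (A i g * B i h - A i h * B i g) * E f
      + (A i g * E h - A i h * E g) * B i f
  have hTG (f g h : R) : derivationBracket A B E f (derivationBracket A B E g h)
      = ∑ i, ∑ j, T i j f g h + ∑ i, G i f g h
        + (f * E (g * E h - h * E g) - (g * E h - h * E g) * E f) := by
    have hT (i j : ι) : A i f * B i (A j g * B j h - A j h * B j g)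
        - A i (A j g * B j h - A j h * B j g) * B i f
        = T i j f g h + if i = j then (A i g * E h - A i h * E g) * B i f else 0 := by
      simp only [T, map_sub, Derivation.leibniz, smul_eq_mul, hAB]
      split_ifs with hij
      · subst hij; ring
      · ring
    simp only [derivationBracket_derivationBracket, hT, G, Finset.sum_add_distrib,
      Finset.sum_ite_eq, Finset.mem_univ, if_true]
    ring
  have hsum : ∑ i, ∑ j, (T i j f g h + T i j g h f + T i j h f g) = 0 := by
    have hneg : ∑ i, ∑ j, (T i j f g h + T i j g h f + T i j h f g)
        = -∑ i, ∑ j, (T i j f g h + T i j g h f + T i j h f g) := by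
      conv_lhs => rw [Finset.sum_comm]
      simp only [← Finset.sum_neg_distrib]
      refine Finset.sum_congr rfl fun i _ => Finset.sum_congr rfl fun j _ => ?_
      simp only [T, hAA i j, hBB i j]
      ring
    have htwo : (2 : 𝕜) • ∑ i, ∑ j, (T i j f g h + T i j g h f + T i j h f g) = 0 := by
      rw [two_smul]
      exact eq_neg_iff_add_eq_zero.1 hneg
    exact (smul_eq_zero.1 htwo).resolve_left two_ne_zero
  have hlin : ∑ i, (G i f g h + G i g h f + G i h f g) = 0 := by
    refine Finset.sum_eq_zero fun i _ => ?_
    simp only [G, map_sub, Derivation.leibniz, smul_eq_mul, hEA, hEB]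
    ring
  simp only [Finset.sum_add_distrib] at hsum hlin
  simp only [hTG, map_sub, Derivation.leibniz, smul_eq_mul]
  linear_combination hsum + hlin

/-- The algebra of smooth functions on `ℝⁿ`. -/
def smoothFunctions (n : ℕ) : Subalgebra ℝ ((Fin n → ℝ) → ℝ) where
  carrier := {f | ContDiff ℝ (⊤ : ℕ∞) f}
  mul_mem' hf hg := Set.mem_ofPred.2 (ContDiff.mul (Set.mem_ofPred.1 hf) (Set.mem_ofPred.1 hg))
  add_mem' hf hg := Set.mem_ofPred.2 (ContDiff.add (Set.mem_ofPred.1 hf) (Set.mem_ofPred.1 hg))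
  algebraMap_mem' _ := Set.mem_ofPred.2 contDiff_const

theorem mem_smoothFunctions {n : ℕ} {f : (Fin n → ℝ) → ℝ} :
    f ∈ smoothFunctions n ↔ ContDiff ℝ (⊤ : ℕ∞) f :=
  Set.mem_ofPred

theorem contDiff_coe {n : ℕ} (f : smoothFunctions n) : ContDiff ℝ (⊤ : ℕ∞) f.1 :=
  mem_smoothFunctions.1 f.2

theorem differentiableAt_coe {n : ℕ} (f : smoothFunctions n) (x : Fin n → ℝ) :
    DifferentiableAt ℝ f.1 x :=
  (contDiff_coe f).differentiable (by simp) x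

theorem contDiff_pd {n : ℕ} {f : (Fin n → ℝ) → ℝ} (hf : ContDiff ℝ (⊤ : ℕ∞) f) (i : Fin n) :
    ContDiff ℝ (⊤ : ℕ∞) (pd f i) :=
  (hf.fderiv_right (m := (⊤ : ℕ∞)) (by simp)).clm_apply contDiff_const

theorem pd_comm {n : ℕ} {f : (Fin n → ℝ) → ℝ} (hf : ContDiff ℝ (⊤ : ℕ∞) f) (i j : Fin n) :
    pd (pd f i) j = pd (pd f j) i := by
  funext x
  have hd : DifferentiableAt ℝ (fderiv ℝ f) x :=
    ((hf.fderiv_right (m := (⊤ : ℕ∞)) (by simp)).differentiable (by simp)).differentiableAt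
  have hpd (k l : Fin n) :
      pd (pd f k) l x = fderiv ℝ (fderiv ℝ f) x (Pi.single l 1) (Pi.single k 1) := by
    change fderiv ℝ (fun y => fderiv ℝ f y (Pi.single k 1)) x _ = _
    rw [fderiv_clm_apply hd (differentiableAt_const _)]
    simp
  rw [hpd, hpd]
  have htwo : (2 : WithTop ℕ∞) ≤ (⊤ : ℕ∞) := WithTop.coe_le_coe.2 (le_top (a := (2 : ℕ∞)))
  exact (hf.contDiffAt.isSymmSndFDerivAt (by simpa using htwo)) _ _

/-- The `i`-th partial derivative as a derivation of the algebra of smooth functions. -/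
noncomputable def pdDerivation {n : ℕ} (i : Fin n) :
    Derivation ℝ (smoothFunctions n) (smoothFunctions n) :=
  Derivation.mk'
    { toFun := fun f => ⟨pd f.1 i, mem_smoothFunctions.2 (contDiff_pd (contDiff_coe f) i)⟩
      map_add' := fun f g => by
        ext x
        simp [pd, fderiv_add (differentiableAt_coe f x) (differentiableAt_coe g x)]
      map_smul' := fun c f => by
        ext x
        simp [pd, fderiv_const_smul (differentiableAt_coe f x)] }
    fun f g => by
      ext x
      simp [pd, fderiv_mul (differentiableAt_coe f x) (differentiableAt_coe g x)]

theorem pdDerivation_comm {n : ℕ} (i j : Fin n) (f : smoothFunctions n) :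
    pdDerivation i (pdDerivation j f) = pdDerivation j (pdDerivation i f) :=
  Subtype.ext (pd_comm (contDiff_coe f) j i)

/-- The `i`-th coordinate as a smooth function. -/
def smoothCoord {n : ℕ} (i : Fin n) : smoothFunctions n :=
  ⟨fun x => x i, mem_smoothFunctions.2 (contDiff_apply ℝ ℝ i)⟩

theorem pdDerivation_smoothCoord {n : ℕ} (i j : Fin n) :
    pdDerivation i (smoothCoord j) = if i = j then 1 else 0 := by
  ext x
  change fderiv ℝ (fun y : Fin n → ℝ => y j) x (Pi.single i 1) = _
  rw [(hasFDerivAt_apply j x).fderiv]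
  split_ifs with hij
  · simp [hij]
  · simp [Ne.symm hij]

/-- The index `m + i` of the `i`-th momentum coordinate. -/
def momentumIndex {m : ℕ} (i : Fin m) : Fin (2 * m + 1) :=
  ⟨m + 1 + i.val, by have := i.isLt; omega⟩

/-- The index `i` of the `i`-th position coordinate. -/
def positionIndex {m : ℕ} (i : Fin m) : Fin (2 * m + 1) :=
  ⟨i.val + 1, by have := i.isLt; omega⟩

/-- The horizontal derivation `x_{m+i} ∂₀ - ∂ᵢ`. -/
noncomputable def horizontalDerivation {m : ℕ} (i : Fin m) :
    Derivation ℝ (smoothFunctions (2 * m + 1)) (smoothFunctions (2 * m + 1)) :=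
  smoothCoord (momentumIndex i) • pdDerivation 0 - pdDerivation (positionIndex i)

theorem horizontalDerivation_apply {m : ℕ} (i : Fin m) (f : smoothFunctions (2 * m + 1)) :
    horizontalDerivation i f
      = smoothCoord (momentumIndex i) * pdDerivation 0 f - pdDerivation (positionIndex i) f :=
  rfl

theorem coe_derivationBracket {m : ℕ} (f g : smoothFunctions (2 * m + 1)) :
    (derivationBracket horizontalDerivation (fun i : Fin m => pdDerivation (momentumIndex i))
      (pdDerivation 0) f g).1 = stdJacobiBracket m f.1 g.1 := by
  funext x
  simp only [derivationBracket, AddSubgroupClass.coe_sub, Subalgebra.coe_add, Subalgebra.coe_mul,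
    AddSubmonoidClass.coe_finsetSum, Pi.sub_apply, Pi.add_apply, Pi.mul_apply, Finset.sum_apply]
  rfl

theorem stdJacobiBracket_jacobi {m : ℕ} (f g h : smoothFunctions (2 * m + 1))
    (x : Fin (2 * m + 1) → ℝ) :
    stdJacobiBracket m f (stdJacobiBracket m g h) x
      + stdJacobiBracket m g (stdJacobiBracket m h f) x
      + stdJacobiBracket m h (stdJacobiBracket m f g) x = 0 := by
  have hp (i j : Fin m) : (momentumIndex i = momentumIndex j) ↔ i = j := by
    simp [momentumIndex, Fin.ext_iff]
  have hz (i : Fin m) : (0 : Fin (2 * m + 1)) ≠ momentumIndex i := by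
    simp only [momentumIndex, ne_eq, Fin.ext_iff, Fin.val_zero]; omega
  have hq (i j : Fin m) : positionIndex i ≠ momentumIndex j := by
    simp only [momentumIndex, positionIndex, ne_eq, Fin.ext_iff]; omega
  have key := derivationBracket_jacobi (𝕜 := ℝ) horizontalDerivation
    (fun i : Fin m => pdDerivation (momentumIndex i)) (pdDerivation 0) ?_ ?_ ?_ ?_ ?_ f g h
  · simpa [coe_derivationBracket] using congrFun (congrArg Subtype.val key) x
  · intro i j f
    simp only [horizontalDerivation_apply, map_sub, Derivation.leibniz, smul_eq_mul,
      pdDerivation_smoothCoord, hz, hq, if_false, pdDerivation_comm 0,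
      pdDerivation_comm (positionIndex i) (positionIndex j)]
    ring
  · exact fun i j f => pdDerivation_comm _ _ f
  · intro i j f
    simp only [horizontalDerivation_apply, map_sub, Derivation.leibniz, smul_eq_mul,
      pdDerivation_smoothCoord, hp, pdDerivation_comm (momentumIndex j), eq_comm (a := j)]
    split_ifs <;> ring
  · intro i f
    simp only [horizontalDerivation_apply, map_sub, Derivation.leibniz, smul_eq_mul,
      pdDerivation_smoothCoord, hz, if_false, pdDerivation_comm 0 (positionIndex i)]
    ring
  · exact fun i f => pdDerivation_comm _ _ f

/-- The standard Jacobi bracket on `ℝ^(2m+1)` is antisymmetric and satisfies the Jacobi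
identity on smooth functions. -/
theorem stdJacobiBracket_antisymm_and_jacobi (m : ℕ)
    (f g h : (Fin (2 * m + 1) → ℝ) → ℝ)
    (hf : ContDiff ℝ (⊤ : ℕ∞) f) (hg : ContDiff ℝ (⊤ : ℕ∞) g) (hh : ContDiff ℝ (⊤ : ℕ∞) h) :
    (∀ x, stdJacobiBracket m g f x = - stdJacobiBracket m f g x) ∧
    (∀ x, stdJacobiBracket m f (stdJacobiBracket m g h) x
        + stdJacobiBracket m g (stdJacobiBracket m h f) x
        + stdJacobiBracket m h (stdJacobiBracket m f g) x = 0) := by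
  refine ⟨fun x => ?_, stdJacobiBracket_jacobi ⟨f, mem_smoothFunctions.2 hf⟩
    ⟨g, mem_smoothFunctions.2 hg⟩ ⟨h, mem_smoothFunctions.2 hh⟩⟩
  simp only [stdJacobiBracket, Finset.sum_sub_distrib]
  ring
end

section
/- Let A be a commutative ℝ-algebra. For k, k' ≥ 1, let D be a k-alternating derivation of A and D' a k'-alternating derivation of A. Then their bracket [D,D'] = D∘D' − (−1)^{(k−1)(k'−1)} D'∘D is a (k+k'−1)-alternating derivation of A; in particular it is alternating, ℝ-multilinear, and satisfies the Leibniz rule in each of its k+k'−1 arguments. -/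
/-- `D : (ℕ → A) → A` is a `k`-alternating derivation of the commutative ℝ-algebra `A`:
it depends only on the first `k` arguments, is ℝ-multilinear and alternating in them,
and satisfies the Leibniz rule in each argument. -/
structure IsAltDeriv {A : Type*} [CommRing A] [Algebra ℝ A]
    (k : ℕ) (D : (ℕ → A) → A) : Prop where
  depends : ∀ f g : ℕ → A, (∀ i < k, f i = g i) → D f = D g
  map_add : ∀ i < k, ∀ (f : ℕ → A) (a b : A),
    D (Function.update f i (a + b))
      = D (Function.update f i a) + D (Function.update f i b)
  map_smul : ∀ i < k, ∀ (f : ℕ → A) (c : ℝ) (a : A),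
    D (Function.update f i (c • a)) = c • D (Function.update f i a)
  alternating : ∀ i j, i < k → j < k → i ≠ j → ∀ f : ℕ → A, f i = f j → D f = 0
  leibniz : ∀ i < k, ∀ (f : ℕ → A) (a b : A),
    D (Function.update f i (a * b))
      = a * D (Function.update f i b) + D (Function.update f i a) * b

/-- `σ` is increasing on the first `c` positions and on the remaining positions. -/
def IsShuffle {N : ℕ} (c : ℕ) (σ : Equiv.Perm (Fin N)) : Prop :=
  (∀ i j : Fin N, i < j → j.val < c → σ i < σ j) ∧
  (∀ i j : Fin N, i < j → c ≤ i.val → σ i < σ j)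

instance {N : ℕ} (c : ℕ) (σ : Equiv.Perm (Fin N)) : Decidable (IsShuffle c σ) :=
  inferInstanceAs (Decidable ((∀ i j : Fin N, i < j → j.val < c → σ i < σ j) ∧
    (∀ i j : Fin N, i < j → c ≤ i.val → σ i < σ j)))

/-- The shuffle composition `D ∘ D'` of a `k`-alternating derivation with a
`k'`-alternating derivation:
`(D∘D')(f₁,…,f_{k+k'−1}) = Σ_σ (−1)^{sign σ} D(D'(f_{σ(1)},…,f_{σ(k')}),
f_{σ(k'+1)},…,f_{σ(k+k'−1)})`, the sum over permutations `σ` of `{1,…,k+k'−1}` with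
`σ(1) < … < σ(k')` and `σ(k'+1) < … < σ(k+k'−1)`. -/
noncomputable def altComp {A : Type*} [CommRing A] [Algebra ℝ A]
    (k k' : ℕ) (D D' : (ℕ → A) → A) : (ℕ → A) → A :=
  fun f => ∑ σ : Equiv.Perm (Fin (k + k' - 1)),
    if IsShuffle k' σ then
      (Equiv.Perm.sign σ : ℤ) •
        D (fun t =>
          if t = 0 then
            D' (fun m => if h : m < k' ∧ m < k + k' - 1 then f (σ ⟨m, h.2⟩) else 0)
          else if h : t < k ∧ k' + t - 1 < k + k' - 1 then f (σ ⟨k' + t - 1, h.2⟩) else 0)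
    else 0

/-- The graded bracket `[D,D'] = D∘D' − (−1)^{(k−1)(k'−1)} D'∘D`. -/
noncomputable def altBracket {A : Type*} [CommRing A] [Algebra ℝ A]
    (k k' : ℕ) (D D' : (ℕ → A) → A) : (ℕ → A) → A :=
  fun f => altComp k k' D D' f - ((-1 : ℤ) ^ ((k - 1) * (k' - 1))) • altComp k' k D' D f

open Equiv Function

/-- A permutation of `Fin N`, extended to `ℕ` by the identity. -/
abbrev natPerm {N : ℕ} (σ : Perm (Fin N)) : Perm ℕ :=
  σ.extendDomain Fin.equivSubtype

section NatPerm

variable {N : ℕ}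

theorem natPerm_of_lt (σ : Perm (Fin N)) {j : ℕ} (h : j < N) :
    natPerm σ j = σ ⟨j, h⟩ :=
  Perm.extendDomain_apply_subtype σ Fin.equivSubtype h

theorem natPerm_lt (σ : Perm (Fin N)) {j : ℕ} (h : j < N) : natPerm σ j < N := by
  rw [natPerm_of_lt σ h]
  exact (σ _).isLt

theorem natPerm_inv_lt (σ : Perm (Fin N)) {j : ℕ} (h : j < N) : (natPerm σ)⁻¹ j < N := by
  rw [Perm.extendDomain_inv]
  exact natPerm_lt _ h

theorem natPerm_mul (σ τ : Perm (Fin N)) : natPerm (σ * τ) = natPerm σ * natPerm τ :=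
  (Perm.extendDomain_mul _ _ _).symm

theorem natPerm_swap (i j : Fin N) : natPerm (swap i j) = swap (i : ℕ) j := by
  ext t
  by_cases h : t < N
  · rw [natPerm_of_lt _ h, swap_apply_def, swap_apply_def]
    simp only [Fin.ext_iff]
    split_ifs <;> rfl
  · refine (Perm.extendDomain_apply_not_subtype _ Fin.equivSubtype h).trans ?_
    rw [swap_apply_of_ne_of_ne] <;> omega

theorem update_comp_natPerm {A : Type*} (σ : Perm (Fin N)) (f : ℕ → A) (i : ℕ) (a : A) :
    update f i a ∘ natPerm σ = update (f ∘ natPerm σ) ((natPerm σ)⁻¹ i) a :=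
  update_comp_equiv f (natPerm σ) i a

/-- The permutation of `Fin N` that permutes the first `m` positions by `α` and the remaining
`p` positions by `β`. -/
def blockPerm {m p : ℕ} (hN : m + p = N) (α : Perm (Fin m)) (β : Perm (Fin p)) :
    Perm (Fin N) :=
  (finSumFinEquiv.trans (finCongr hN)).permCongr (Perm.sumCongr α β)

variable {m p : ℕ} (hN : m + p = N) (α : Perm (Fin m)) (β : Perm (Fin p))

theorem sign_blockPerm :
    Perm.sign (blockPerm hN α β) = Perm.sign α * Perm.sign β := by
  rw [blockPerm, Perm.sign_permCongr, Perm.sign_sumCongr]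

theorem blockPerm_castAdd (i : Fin m) :
    blockPerm hN α β (finCongr hN (Fin.castAdd p i)) = finCongr hN (Fin.castAdd p (α i)) := by
  subst hN
  simp [blockPerm, Equiv.permCongr_apply]

theorem blockPerm_natAdd (j : Fin p) :
    blockPerm hN α β (finCongr hN (Fin.natAdd m j)) = finCongr hN (Fin.natAdd m (β j)) := by
  subst hN
  simp [blockPerm, Equiv.permCongr_apply]

theorem natPerm_blockPerm_of_lt {j : ℕ} (h : j < m) :
    natPerm (blockPerm hN α β) j = natPerm α j := by
  rw [natPerm_of_lt _ (by omega : j < N), natPerm_of_lt _ h]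
  exact congrArg Fin.val (blockPerm_castAdd hN α β ⟨j, h⟩)

theorem natPerm_blockPerm_add {j : ℕ} (h : j < p) :
    natPerm (blockPerm hN α β) (m + j) = m + natPerm β j := by
  rw [natPerm_of_lt _ (by omega : m + j < N), natPerm_of_lt _ h]
  exact congrArg Fin.val (blockPerm_natAdd hN α β ⟨j, h⟩)

theorem isShuffle_iff (σ : Perm (Fin N)) :
    IsShuffle m σ ↔ StrictMono (fun i : Fin m => σ (finCongr hN (Fin.castAdd p i))) ∧
      StrictMono (fun j : Fin p => σ (finCongr hN (Fin.natAdd m j))) := by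
  subst hN
  refine and_congr ⟨fun h i j hij => h _ _ hij (by simp), fun h i j hij hj => ?_⟩
    ⟨fun h i j hij => h _ _ (by simpa using hij) (by simp), fun h i j hij hi => ?_⟩
  · exact @h ⟨i, lt_trans (Fin.lt_def.1 hij) hj⟩ ⟨j, hj⟩ hij
  · have := @h ⟨i - m, by omega⟩ ⟨j - m, by omega⟩ (by simp only [Fin.lt_def] at hij ⊢; omega)
    have e : ∀ l : Fin (m + p), m ≤ l → ∀ hl : l - m < p, Fin.natAdd m ⟨l - m, hl⟩ = l :=
      fun l hl _ => Fin.ext (by simp; omega)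
    simpa [e i hi, e j (hi.trans (le_of_lt hij))] using this

theorem strictMono_comp_perm_iff {n : ℕ} {γ : Type*} [LinearOrder γ] {f : Fin n → γ}
    (hf : Injective f) (τ : Perm (Fin n)) : StrictMono (f ∘ τ) ↔ τ = Tuple.sort f := by
  rw [Tuple.eq_sort_iff]
  refine ⟨fun h => ⟨h.monotone, fun i j hij e => ?_⟩,
    fun h => h.1.strictMono_of_injective (hf.comp τ.injective)⟩
  exact absurd (τ.injective (hf e)) hij.ne

theorem isShuffle_mul_blockPerm_iff (σ : Perm (Fin N)) :
    IsShuffle m (σ * blockPerm hN α β) ↔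
      α = Tuple.sort (fun i : Fin m => σ (finCongr hN (Fin.castAdd p i))) ∧
      β = Tuple.sort (fun j : Fin p => σ (finCongr hN (Fin.natAdd m j))) := by
  rw [isShuffle_iff hN, ← strictMono_comp_perm_iff, ← strictMono_comp_perm_iff]
  · simp only [Perm.mul_apply, blockPerm_castAdd, blockPerm_natAdd]
    rfl
  · exact σ.injective.comp ((finCongr hN).injective.comp (Fin.natAdd_injective p m))
  · exact σ.injective.comp ((finCongr hN).injective.comp (Fin.castAdd_injective m p))

/-- A function on permutations invariant under permuting the two blocks sums over all
permutations to `m! * p!` times its sum over the shuffles. -/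
theorem sum_perm_eq_smul_sum_isShuffle {M : Type*} [AddCommMonoid M] (F : Perm (Fin N) → M)
    (hF : ∀ σ α β, F (σ * blockPerm hN α β) = F σ) :
    ∑ σ, F σ = (m.factorial * p.factorial) • ∑ σ, if IsShuffle m σ then F σ else 0 := by
  calc ∑ σ, F σ
      = ∑ σ, ∑ x : Perm (Fin m) × Perm (Fin p),
          if IsShuffle m (σ * blockPerm hN x.1 x.2) then F (σ * blockPerm hN x.1 x.2) else 0 := by
        refine Finset.sum_congr rfl fun σ _ => ?_
        simp only [isShuffle_mul_blockPerm_iff, hF, ← Prod.ext_iff (y := (_, _))]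
        simp
    _ = ∑ _x : Perm (Fin m) × Perm (Fin p), ∑ σ, if IsShuffle m σ then F σ else 0 := by
        rw [Finset.sum_comm]
        exact Finset.sum_congr rfl fun x _ =>
          Fintype.sum_equiv (Equiv.mulRight (blockPerm hN x.1 x.2)) _ _ fun σ => rfl
    _ = _ := by simp [Fintype.card_perm, Fintype.card_prod]

end NatPerm

section Rotation

theorem val_finRotate_pow {n : ℕ} (s : ℕ) (i : Fin n) :
    ((finRotate n ^ s) i : ℕ) = (i + s) % n := by
  induction s with
  | zero => simp [Nat.mod_eq_of_lt i.isLt]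
  | succ s ih =>
    obtain ⟨n, rfl⟩ := Nat.exists_eq_succ_of_ne_zero i.pos.ne'
    rw [pow_succ', Perm.mul_apply, finRotate_apply, Fin.val_add, ih, Fin.val_one', ← Nat.add_mod,
      add_assoc]

/-- The permutation of `Fin (p + q + 1)` that fixes `0` and exchanges the first `p` of the
remaining positions with the last `q`. -/
def tailRotate (p q : ℕ) : Perm (Fin (p + q + 1)) :=
  Perm.decomposeFin.symm (0, finRotate (p + q) ^ q)

theorem sign_tailRotate (p q : ℕ) : Perm.sign (tailRotate p q) = (-1) ^ (p * q) := by
  rw [tailRotate, Perm.decomposeFin.symm_sign, if_pos rfl, one_mul, map_pow, sign_finRotate,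
    ← pow_mul]
  rcases q with _ | q
  · simp
  · have : (p + (q + 1) - 1) * (q + 1) = p * (q + 1) + q * (q + 1) := by
      rw [← add_assoc, Nat.add_sub_cancel]; ring
    rw [this, pow_add, (Nat.even_mul_succ_self q).neg_one_pow, mul_one]

theorem natPerm_tailRotate_zero (p q : ℕ) : natPerm (tailRotate p q) 0 = 0 := by
  rw [natPerm_of_lt _ (Nat.succ_pos _)]
  exact congrArg Fin.val (Perm.decomposeFin_symm_apply_zero _ _)

theorem natPerm_tailRotate_succ (p q : ℕ) {j : ℕ} (h : j < p + q) :
    natPerm (tailRotate p q) (j + 1) = (j + q) % (p + q) + 1 := by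
  rw [natPerm_of_lt _ (Nat.succ_lt_succ h)]
  have := Perm.decomposeFin_symm_apply_succ (finRotate (p + q) ^ q) 0 ⟨j, h⟩
  rw [swap_self, refl_apply] at this
  refine (congrArg Fin.val this).trans ?_
  rw [Fin.val_succ, val_finRotate_pow]

theorem natPerm_tailRotate_of_le {p q t : ℕ} (h0 : t ≠ 0) (h : t ≤ p) :
    natPerm (tailRotate p q) t = q + t := by
  obtain ⟨j, rfl⟩ := Nat.exists_eq_succ_of_ne_zero h0
  rw [Nat.succ_eq_add_one, natPerm_tailRotate_succ p q (by omega), Nat.mod_eq_of_lt (by omega)]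
  omega

theorem natPerm_tailRotate_add {p q t : ℕ} (h0 : t ≠ 0) (h : t ≤ q) :
    natPerm (tailRotate p q) (p + t) = t := by
  obtain ⟨j, rfl⟩ := Nat.exists_eq_succ_of_ne_zero h0
  rw [Nat.succ_eq_add_one, ← add_assoc, natPerm_tailRotate_succ p q (by omega),
    show p + j + q = j + (p + q) by ring, Nat.add_mod_right, Nat.mod_eq_of_lt (by omega)]

end Rotation

namespace IsAltDeriv

variable {A : Type*} [CommRing A] [Algebra ℝ A] {k : ℕ} {D : (ℕ → A) → A}

/-- The alternating map underlying an alternating derivation. -/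
def toAlternatingMap (hD : IsAltDeriv k D) : A [⋀^Fin k]→ₗ[ℝ] A where
  toFun v := D fun j => if h : j < k then v ⟨j, h⟩ else 0
  map_update_add' {inst} v i x y := by
    have e : ∀ z, (fun j => if h : j < k then @update _ _ inst v i z ⟨j, h⟩ else 0) =
        update (fun j => if h : j < k then v ⟨j, h⟩ else 0) i z := fun z => by
      ext j
      by_cases hj : j = i
      · subst hj; simp
      · have : ∀ h : j < k, (⟨j, h⟩ : Fin k) ≠ i := fun h e => hj (congrArg Fin.val e)
        simp [update_of_ne hj, update_of_ne (this _)]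
    simp only [e, hD.map_add i i.isLt]
  map_update_smul' {inst} v i c x := by
    have e : ∀ z, (fun j => if h : j < k then @update _ _ inst v i z ⟨j, h⟩ else 0) =
        update (fun j => if h : j < k then v ⟨j, h⟩ else 0) i z := fun z => by
      ext j
      by_cases hj : j = i
      · subst hj; simp
      · have : ∀ h : j < k, (⟨j, h⟩ : Fin k) ≠ i := fun h e => hj (congrArg Fin.val e)
        simp [update_of_ne hj, update_of_ne (this _)]
    simp only [e, hD.map_smul i i.isLt]
  map_eq_zero_of_eq' v i j hv hij :=
    hD.alternating i j i.isLt j.isLt (fun h => hij (Fin.ext h)) _ (by simp [hv])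

theorem map_perm (hD : IsAltDeriv k D) (f : ℕ → A) (σ : Perm (Fin k)) :
    D (f ∘ natPerm σ) = (Perm.sign σ : ℤ) • D f := by
  have h := hD.toAlternatingMap.map_perm (fun i : Fin k => f i) σ
  rw [Units.smul_def] at h
  have e : ∀ g : ℕ → A, hD.toAlternatingMap (fun i : Fin k => g i) = D g := fun g =>
    hD.depends _ _ fun i hi => by simp [hi]
  rw [← e f, ← h, ← e]
  congr 1
  ext i
  simp [natPerm_of_lt σ i.isLt]

theorem map_zsmul (hD : IsAltDeriv k D) {i : ℕ} (hi : i < k) (f : ℕ → A) (n : ℤ) (a : A) :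
    D (update f i (n • a)) = n • D (update f i a) := by
  rw [← Int.cast_smul_eq_zsmul ℝ, hD.map_smul i hi, Int.cast_smul_eq_zsmul]

end IsAltDeriv

/-- The insertion `D(D'(g₀,…,g_q), g_{q+1}, g_{q+2}, …)`. -/
def altInsert {A : Type*} (q : ℕ) (D D' : (ℕ → A) → A) (g : ℕ → A) : A :=
  D (update (fun t => g (q + t)) 0 (D' g))

/-- The signed sum of `C` over all permutations of the first `N` arguments. -/
noncomputable def altSum {A : Type*} [CommRing A] (N : ℕ) (C : (ℕ → A) → A) (f : ℕ → A) : A :=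
  ∑ σ : Perm (Fin N), (Perm.sign σ : ℤ) • C (f ∘ natPerm σ)

section AltSum

variable {A : Type*} [CommRing A] {N : ℕ} {C : (ℕ → A) → A}

theorem altSum_congr (hC : ∀ f g : ℕ → A, (∀ i < N, f i = g i) → C f = C g) (f g : ℕ → A)
    (h : ∀ i < N, f i = g i) : altSum N C f = altSum N C g :=
  Finset.sum_congr rfl fun σ _ => by
    rw [hC (f ∘ natPerm σ) (g ∘ natPerm σ) fun i hi => h _ (natPerm_lt σ hi)]

theorem altSum_update_add
    (hC : ∀ i < N, ∀ (f : ℕ → A) (a b : A),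
      C (update f i (a + b)) = C (update f i a) + C (update f i b))
    {i : ℕ} (hi : i < N) (f : ℕ → A) (a b : A) :
    altSum N C (update f i (a + b)) = altSum N C (update f i a) + altSum N C (update f i b) := by
  simp only [altSum, update_comp_natPerm, ← Finset.sum_add_distrib, ← smul_add]
  exact Finset.sum_congr rfl fun σ _ => by rw [hC _ (natPerm_inv_lt σ hi)]

theorem altSum_update_smul [Algebra ℝ A]
    (hC : ∀ i < N, ∀ (f : ℕ → A) (c : ℝ) (a : A),
      C (update f i (c • a)) = c • C (update f i a))
    {i : ℕ} (hi : i < N) (f : ℕ → A) (c : ℝ) (a : A) :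
    altSum N C (update f i (c • a)) = c • altSum N C (update f i a) := by
  simp only [altSum, update_comp_natPerm, Finset.smul_sum]
  exact Finset.sum_congr rfl fun σ _ => by rw [hC _ (natPerm_inv_lt σ hi), smul_comm]

theorem altSum_eq_zero [Algebra ℝ A] {i j : ℕ} (hi : i < N) (hj : j < N) (hij : i ≠ j) (f : ℕ → A)
    (hf : f i = f j) : altSum N C f = 0 := by
  have hs : f ∘ swap i j = f := by
    ext t
    rw [comp_apply, swap_apply_def]
    split_ifs with h h
    · rw [h, hf]
    · rw [h, hf]
    · rfl
  have h : altSum N C f = -altSum N C f := by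
    conv_lhs => rw [altSum]
    rw [altSum, ← Finset.sum_neg_distrib]
    refine Fintype.sum_equiv (Equiv.mulLeft (swap (⟨i, hi⟩ : Fin N) ⟨j, hj⟩)) _ _ fun σ => ?_
    rw [coe_mulLeft, natPerm_mul, natPerm_swap, Perm.coe_mul, ← comp_assoc, hs, Perm.sign_mul,
      Perm.sign_swap (by simpa using hij)]
    simp
  have h2 : (2 : ℝ) • altSum N C f = 0 := by
    rw [two_smul]
    nth_rewrite 1 [h]
    exact neg_add_cancel _
  exact (smul_eq_zero_iff_right two_ne_zero).1 h2

end AltSum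

theorem altInsert_update_of_le {A : Type*} {D D' : (ℕ → A) → A} {q i : ℕ} (hi : i ≤ q) (g : ℕ → A) (a : A) :
    altInsert q D D' (update g i a) =
      D (update (fun t => g (q + t)) 0 (D' (update g i a))) := by
  unfold altInsert
  congr 1
  ext t
  rcases eq_or_ne t 0 with rfl | ht
  · simp
  · rw [update_of_ne ht, update_of_ne ht, update_of_ne (by omega)]

section AltInsert

variable {A : Type*} [CommRing A] [Algebra ℝ A] {p q : ℕ} {D D' : (ℕ → A) → A}

theorem altInsert_update_add (hD' : IsAltDeriv (q + 1) D') {i : ℕ} (hi : i ≠ 0) (g : ℕ → A)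
    (a : A) :
    altInsert q D D' (update g (q + i) a) =
      D (update (update (fun t => g (q + t)) 0 (D' g)) i a) := by
  have e : D' (update g (q + i) a) = D' g :=
    hD'.depends _ _ fun j hj => update_of_ne (by omega) _ _
  unfold altInsert
  rw [e, update_comm hi.symm]
  congr 2
  ext t
  rcases eq_or_ne t i with rfl | ht
  · simp
  · rw [update_of_ne ht, update_of_ne (by omega)]

theorem altInsert_congr (hD : IsAltDeriv (p + 1) D) (hD' : IsAltDeriv (q + 1) D')
    (f g : ℕ → A) (h : ∀ i < p + q + 1, f i = g i) : altInsert q D D' f = altInsert q D D' g := by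
  unfold altInsert
  rw [hD'.depends f g fun i hi => h i (by omega)]
  refine hD.depends _ _ fun t ht => ?_
  rcases eq_or_ne t 0 with rfl | h0
  · simp
  · rw [update_of_ne h0, update_of_ne h0, h _ (by omega)]

theorem altInsert_update_map_add (hD : IsAltDeriv (p + 1) D) (hD' : IsAltDeriv (q + 1) D')
    (i : ℕ) (hi : i < p + q + 1) (g : ℕ → A) (a b : A) :
    altInsert q D D' (update g i (a + b)) =
      altInsert q D D' (update g i a) + altInsert q D D' (update g i b) := by
  rcases le_or_gt i q with h | h
  · simp only [altInsert_update_of_le h, hD'.map_add i (Nat.lt_succ_of_le h),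
      hD.map_add 0 p.succ_pos]
  · obtain ⟨j, rfl⟩ := Nat.exists_eq_add_of_lt h
    simp only [add_assoc q, altInsert_update_add hD' (Nat.succ_ne_zero j),
      hD.map_add (j + 1) (by omega)]

theorem altInsert_update_map_smul (hD : IsAltDeriv (p + 1) D) (hD' : IsAltDeriv (q + 1) D')
    (i : ℕ) (hi : i < p + q + 1) (g : ℕ → A) (c : ℝ) (a : A) :
    altInsert q D D' (update g i (c • a)) = c • altInsert q D D' (update g i a) := by
  rcases le_or_gt i q with h | h
  · simp only [altInsert_update_of_le h, hD'.map_smul i (Nat.lt_succ_of_le h),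
      hD.map_smul 0 p.succ_pos]
  · obtain ⟨j, rfl⟩ := Nat.exists_eq_add_of_lt h
    simp only [add_assoc q, altInsert_update_add hD' (Nat.succ_ne_zero j),
      hD.map_smul (j + 1) (by omega)]

/-- The Leibniz rule for an insertion, with its cross terms. -/
theorem altInsert_update_mul (hD : IsAltDeriv (p + 1) D) (hD' : IsAltDeriv (q + 1) D')
    (i : ℕ) (hi : i < p + q + 1) (g : ℕ → A) (a b : A) :
    altInsert q D D' (update g i (a * b)) =
      a * altInsert q D D' (update g i b) + altInsert q D D' (update g i a) * b +
      ((if i < q + 1 then D (update (fun t => g (q + t)) 0 a) * D' (update g i b) else 0) +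
        if i < q + 1 then D (update (fun t => g (q + t)) 0 b) * D' (update g i a) else 0) := by
  rcases le_or_gt i q with h | h
  · simp only [altInsert_update_of_le h, hD'.leibniz i (Nat.lt_succ_of_le h),
      hD.map_add 0 p.succ_pos, hD.leibniz 0 p.succ_pos, if_pos (Nat.lt_succ_of_le h)]
    ring
  · rw [if_neg (by omega), if_neg (by omega)]
    obtain ⟨j, rfl⟩ := Nat.exists_eq_add_of_lt h
    simp only [add_assoc q, altInsert_update_add hD' (Nat.succ_ne_zero j),
      hD.leibniz (j + 1) (by omega), add_zero]

theorem altInsert_comp_blockPerm (hD : IsAltDeriv (p + 1) D) (hD' : IsAltDeriv (q + 1) D')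
    {N : ℕ} (hN : q + 1 + p = N) (g : ℕ → A) (α : Perm (Fin (q + 1))) (β : Perm (Fin p)) :
    altInsert q D D' (g ∘ natPerm (blockPerm hN α β)) =
      ((Perm.sign α : ℤ) * (Perm.sign β : ℤ)) • altInsert q D D' g := by
  have h1 : D' (g ∘ natPerm (blockPerm hN α β)) = (Perm.sign α : ℤ) • D' g := by
    rw [← hD'.map_perm]
    exact hD'.depends _ _ fun i hi => congrArg g (natPerm_blockPerm_of_lt hN α β hi)
  set β' : Perm (Fin (p + 1)) := Perm.decomposeFin.symm (0, β)
  have hβ : Perm.sign β' = Perm.sign β := by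
    rw [Perm.decomposeFin.symm_sign, if_pos rfl, one_mul]
  have h0 : natPerm β' 0 = 0 := by
    rw [natPerm_of_lt _ p.succ_pos]
    exact congrArg Fin.val (Perm.decomposeFin_symm_apply_zero _ _)
  have hs : ∀ t < p, natPerm β' (t + 1) = natPerm β t + 1 := fun t ht => by
    rw [natPerm_of_lt _ (Nat.succ_lt_succ ht), natPerm_of_lt _ ht]
    have := Perm.decomposeFin_symm_apply_succ β 0 ⟨t, ht⟩
    rw [swap_self, refl_apply] at this
    exact congrArg Fin.val this
  rw [altInsert, h1, hD.map_zsmul p.succ_pos, mul_smul, altInsert, ← hβ, ← hD.map_perm]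
  congr 1
  refine hD.depends _ _ fun t ht => ?_
  rcases t with _ | t
  · simp [h0]
  · rw [update_of_ne t.succ_ne_zero, comp_apply, comp_apply, hs t (by omega),
      update_of_ne (Nat.succ_ne_zero _), show q + (t + 1) = q + 1 + t by ring,
      natPerm_blockPerm_add hN α β (by omega)]
    congr 1
    omega

theorem altComp_eq_sum (hD : IsAltDeriv (p + 1) D) (hD' : IsAltDeriv (q + 1) D') {N : ℕ}
    (hN : p + 1 + (q + 1) - 1 = N) (f : ℕ → A) :
    altComp (p + 1) (q + 1) D D' f = ∑ σ : Perm (Fin N), if IsShuffle (q + 1) σ then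
      (Perm.sign σ : ℤ) • altInsert q D D' (f ∘ natPerm σ) else 0 := by
  subst hN
  unfold altComp altInsert
  refine Finset.sum_congr rfl fun σ _ => ?_
  congr 2
  refine hD.depends _ _ fun t ht => ?_
  rcases eq_or_ne t 0 with rfl | h0
  · rw [if_pos rfl, update_self]
    refine hD'.depends _ _ fun m hm => ?_
    have h : m < p + 1 + (q + 1) - 1 := by omega
    rw [dif_pos ⟨hm, h⟩, comp_apply, natPerm_of_lt σ h]
  · have h : q + 1 + t - 1 < p + 1 + (q + 1) - 1 := by omega
    have e : q + t = q + 1 + t - 1 := by omega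
    rw [if_neg h0, dif_pos ⟨ht, h⟩, update_of_ne h0, comp_apply, e, natPerm_of_lt σ h]

theorem altSum_altInsert (hD : IsAltDeriv (p + 1) D) (hD' : IsAltDeriv (q + 1) D') {N : ℕ}
    (hN : p + q + 1 = N) (f : ℕ → A) :
    altSum N (altInsert q D D') f =
      ((q + 1).factorial * p.factorial) • altComp (p + 1) (q + 1) D D' f := by
  rw [altComp_eq_sum hD hD' (N := N) (by omega), altSum]
  refine sum_perm_eq_smul_sum_isShuffle (m := q + 1) (p := p) (by omega) _ fun σ α β => ?_
  rw [natPerm_mul, Perm.coe_mul, ← comp_assoc, altInsert_comp_blockPerm hD hD', Perm.sign_mul,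
    sign_blockPerm, smul_smul]
  congr 1
  rcases Int.units_eq_one_or (Perm.sign α) with h | h <;>
    rcases Int.units_eq_one_or (Perm.sign β) with h' | h' <;> simp [h, h']

end AltInsert

/-- The signed sum of `D(a, f_{σ(q+1)}, …) * D'(b, f_{σ(1)}, …, f_{σ(q)})` over the
permutations `σ` of the first `N` arguments with `σ(0) = i`. -/
noncomputable def crossSum {A : Type*} [CommRing A] (N q : ℕ) (D D' : (ℕ → A) → A) (f : ℕ → A) (i : ℕ) (a b : A) : A :=
  ∑ σ : Perm (Fin N), if natPerm σ 0 = i then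
    (Perm.sign σ : ℤ) • (D (update (fun t => f (natPerm σ (q + t))) 0 a) *
      D' (update (f ∘ natPerm σ) 0 b)) else 0

section Leibniz

variable {A : Type*} [CommRing A] [Algebra ℝ A] {p q : ℕ} {D D' : (ℕ → A) → A}

theorem sum_cross_at (hD' : IsAltDeriv (q + 1) D') {N : ℕ} (hN : q < N) (f : ℕ → A)
    (i : ℕ) (a b : A) {j : ℕ} (hj : j < q + 1) :
    (∑ σ : Perm (Fin N), if natPerm σ j = i then
      (Perm.sign σ : ℤ) • (D (update (fun t => f (natPerm σ (q + t))) 0 a) *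
        D' (update (f ∘ natPerm σ) j b)) else 0) = crossSum N q D D' f i a b := by
  have h0 : 0 < N := by omega
  have hjN : j < N := by omega
  rcases eq_or_ne j 0 with rfl | hj0
  · rfl
  refine Fintype.sum_equiv (Equiv.mulRight (swap (⟨0, h0⟩ : Fin N) ⟨j, hjN⟩)) _ _ fun σ => ?_
  have hsig : Perm.sign (swap (⟨0, h0⟩ : Fin N) ⟨j, hjN⟩) = -1 :=
    Perm.sign_swap (by simpa using hj0.symm)
  have hsw : natPerm (swap (⟨0, h0⟩ : Fin N) ⟨j, hjN⟩) = swap 0 j := natPerm_swap _ _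
  have e1 : update (fun t => f (natPerm σ (swap 0 j (q + t)))) 0 a =
      update (fun t => f (natPerm σ (q + t))) 0 a := by
    ext t
    rcases eq_or_ne t 0 with rfl | ht
    · simp
    · rw [update_of_ne ht, update_of_ne ht, swap_apply_of_ne_of_ne] <;> omega
  have e2 : D' (update (f ∘ (natPerm σ ∘ swap 0 j)) 0 b) =
      -D' (update (f ∘ natPerm σ) j b) := by
    have hp := hD'.map_perm (update (f ∘ natPerm σ) j b)
      (swap (⟨0, q.succ_pos⟩ : Fin (q + 1)) ⟨j, hj⟩)
    rw [natPerm_swap, Perm.sign_swap (by simpa using hj0), update_comp_equiv] at hp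
    simpa [comp_assoc] using hp
  rw [coe_mulRight, natPerm_mul, hsw, Perm.sign_mul, hsig]
  simp only [Perm.mul_apply, swap_apply_left, Perm.coe_mul, e1, e2]
  simp

theorem sum_cross (hD' : IsAltDeriv (q + 1) D') {N : ℕ} (hN : q < N) (f : ℕ → A)
    (i : ℕ) (a b : A) :
    (∑ σ : Perm (Fin N), (Perm.sign σ : ℤ) • if (natPerm σ)⁻¹ i < q + 1 then
      (D (update (fun t => (f ∘ natPerm σ) (q + t)) 0 a) *
        D' (update (f ∘ natPerm σ) ((natPerm σ)⁻¹ i) b)) else 0) =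
      (q + 1) • crossSum N q D D' f i a b := by
  calc _ = ∑ σ : Perm (Fin N), ∑ j ∈ Finset.range (q + 1), if natPerm σ j = i then
      (Perm.sign σ : ℤ) • (D (update (fun t => f (natPerm σ (q + t))) 0 a) *
        D' (update (f ∘ natPerm σ) j b)) else 0 := by
        refine Finset.sum_congr rfl fun σ _ => ?_
        simp only [← Perm.eq_inv_iff_eq, Finset.sum_ite_eq', Finset.mem_range, comp_apply]
        split_ifs <;> simp
    _ = _ := by
        rw [Finset.sum_comm, Finset.sum_congr rfl fun j hj =>
          sum_cross_at hD' hN f i a b (Finset.mem_range.1 hj)]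
        simp

theorem altSum_altInsert_update_mul (hD : IsAltDeriv (p + 1) D) (hD' : IsAltDeriv (q + 1) D')
    {N : ℕ} (hN : p + q + 1 = N) {i : ℕ} (hi : i < N) (f : ℕ → A) (a b : A) :
    altSum N (altInsert q D D') (update f i (a * b)) =
      a * altSum N (altInsert q D D') (update f i b) +
      altSum N (altInsert q D D') (update f i a) * b +
      (q + 1) • (crossSum N q D D' f i a b + crossSum N q D D' f i b a) := by
  subst hN
  rw [smul_add, ← sum_cross hD' (by omega), ← sum_cross hD' (by omega)]
  simp only [altSum, update_comp_natPerm, Finset.mul_sum, Finset.sum_mul,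
    ← Finset.sum_add_distrib]
  refine Finset.sum_congr rfl fun σ _ => ?_
  rw [altInsert_update_mul hD hD' _ (natPerm_inv_lt σ hi)]
  simp only [smul_add, mul_smul_comm, smul_mul_assoc]

theorem altComp_update_mul (hD : IsAltDeriv (p + 1) D) (hD' : IsAltDeriv (q + 1) D')
    {N : ℕ} (hN : p + q + 1 = N) {i : ℕ} (hi : i < N) (f : ℕ → A) (a b : A) :
    (p.factorial * q.factorial) • altComp (p + 1) (q + 1) D D' (update f i (a * b)) =
      (p.factorial * q.factorial) • (a * altComp (p + 1) (q + 1) D D' (update f i b) +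
        altComp (p + 1) (q + 1) D D' (update f i a) * b) +
      (crossSum N q D D' f i a b + crossSum N q D D' f i b a) := by
  have h := altSum_altInsert_update_mul hD hD' hN hi f a b
  simp only [altSum_altInsert hD hD' hN] at h
  have hq : ((q + 1 : ℕ) : ℝ) ≠ 0 := Nat.cast_ne_zero.2 q.succ_ne_zero
  rw [← sub_eq_zero, ← smul_eq_zero_iff_right hq, Nat.cast_smul_eq_nsmul]
  rw [← sub_eq_zero] at h
  refine Eq.trans ?_ h
  simp only [nsmul_eq_mul, Nat.factorial_succ]
  push_cast
  ring

theorem crossSum_comm (hD : IsAltDeriv (p + 1) D) (hD' : IsAltDeriv (q + 1) D')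
    (f : ℕ → A) (i : ℕ) (a b : A) :
    crossSum (p + q + 1) p D' D f i b a =
      (-1 : ℤ) ^ (p * q) • crossSum (p + q + 1) q D D' f i a b := by
  unfold crossSum
  rw [Finset.smul_sum]
  symm
  refine Fintype.sum_equiv (Equiv.mulRight (tailRotate p q)) _ _ fun σ => ?_
  have e1 : D (update (f ∘ (natPerm σ ∘ natPerm (tailRotate p q))) 0 a) =
      D (update (fun t => f (natPerm σ (q + t))) 0 a) :=
    hD.depends _ _ fun t ht => by
      rcases eq_or_ne t 0 with rfl | h0
      · simp
      · rw [update_of_ne h0, update_of_ne h0, comp_apply, comp_apply,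
          natPerm_tailRotate_of_le h0 (by omega)]
  have e2 : D' (update (fun t => f (natPerm σ (natPerm (tailRotate p q) (p + t)))) 0 b) =
      D' (update (f ∘ natPerm σ) 0 b) :=
    hD'.depends _ _ fun t ht => by
      rcases eq_or_ne t 0 with rfl | h0
      · simp
      · rw [update_of_ne h0, update_of_ne h0, comp_apply,
          natPerm_tailRotate_add h0 (by omega)]
  rw [coe_mulRight, natPerm_mul, Perm.sign_mul, sign_tailRotate]
  simp only [Perm.mul_apply, natPerm_tailRotate_zero, Perm.coe_mul, e1, e2]
  split_ifs
  · rw [smul_smul, mul_comm (D' _)]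
    push_cast
    rw [mul_comm ((-1 : ℤ) ^ _)]
  · simp

end Leibniz

section AltComp

variable {A : Type*} [CommRing A] [Algebra ℝ A] {p q : ℕ} {D D' : (ℕ → A) → A}

theorem altComp_eq_smul_altSum (hD : IsAltDeriv (p + 1) D) (hD' : IsAltDeriv (q + 1) D') {N : ℕ}
    (hN : p + q + 1 = N) (f : ℕ → A) :
    altComp (p + 1) (q + 1) D D' f =
      ((((q + 1).factorial * p.factorial : ℕ) : ℝ)⁻¹) • altSum N (altInsert q D D') f := by
  rw [altSum_altInsert hD hD' hN, ← Nat.cast_smul_eq_nsmul ℝ, inv_smul_smul₀]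
  exact Nat.cast_ne_zero.2 (mul_ne_zero (Nat.factorial_ne_zero _) (Nat.factorial_ne_zero _))

theorem altComp_congr (hD : IsAltDeriv (p + 1) D) (hD' : IsAltDeriv (q + 1) D') {N : ℕ}
    (hN : p + q + 1 = N) (f g : ℕ → A) (h : ∀ i < N, f i = g i) :
    altComp (p + 1) (q + 1) D D' f = altComp (p + 1) (q + 1) D D' g := by
  subst hN
  simp only [altComp_eq_smul_altSum hD hD' rfl, altSum_congr (altInsert_congr hD hD') f g h]

theorem altComp_update_add (hD : IsAltDeriv (p + 1) D) (hD' : IsAltDeriv (q + 1) D') {N : ℕ}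
    (hN : p + q + 1 = N) {i : ℕ} (hi : i < N) (f : ℕ → A) (a b : A) :
    altComp (p + 1) (q + 1) D D' (update f i (a + b)) =
      altComp (p + 1) (q + 1) D D' (update f i a) +
        altComp (p + 1) (q + 1) D D' (update f i b) := by
  subst hN
  simp only [altComp_eq_smul_altSum hD hD' rfl,
    altSum_update_add (altInsert_update_map_add hD hD') hi, smul_add]

theorem altComp_update_smul (hD : IsAltDeriv (p + 1) D) (hD' : IsAltDeriv (q + 1) D') {N : ℕ}
    (hN : p + q + 1 = N) {i : ℕ} (hi : i < N) (f : ℕ → A) (c : ℝ) (a : A) :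
    altComp (p + 1) (q + 1) D D' (update f i (c • a)) =
      c • altComp (p + 1) (q + 1) D D' (update f i a) := by
  subst hN
  simp only [altComp_eq_smul_altSum hD hD' rfl,
    altSum_update_smul (altInsert_update_map_smul hD hD') hi]
  rw [smul_comm]

theorem altComp_eq_zero (hD : IsAltDeriv (p + 1) D) (hD' : IsAltDeriv (q + 1) D') {N : ℕ}
    (hN : p + q + 1 = N) {i j : ℕ} (hi : i < N) (hj : j < N) (hij : i ≠ j) (f : ℕ → A)
    (hf : f i = f j) : altComp (p + 1) (q + 1) D D' f = 0 := by
  rw [altComp_eq_smul_altSum hD hD' hN, altSum_eq_zero hi hj hij f hf, smul_zero]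

end AltComp

/-- The bracket of a `k`-alternating derivation and a `k'`-alternating derivation
(`k, k' ≥ 1`) is a `(k+k'−1)`-alternating derivation. -/
theorem altBracket_isAltDeriv {A : Type*} [CommRing A] [Algebra ℝ A]
    (k k' : ℕ) (hk : 1 ≤ k) (hk' : 1 ≤ k')
    (D D' : (ℕ → A) → A) (hD : IsAltDeriv k D) (hD' : IsAltDeriv k' D') :
    IsAltDeriv (k + k' - 1) (altBracket k k' D D') := by
  obtain ⟨p, rfl⟩ := Nat.exists_eq_add_of_le' hk
  obtain ⟨q, rfl⟩ := Nat.exists_eq_add_of_le' hk'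
  have hN : p + 1 + (q + 1) - 1 = p + q + 1 := by omega
  have hN' : q + p + 1 = p + q + 1 := by omega
  rw [hN]
  refine ⟨fun f g h => ?_, fun i hi f a b => ?_, fun i hi f c a => ?_,
    fun i j hi hj hij f hf => ?_, fun i hi f a b => ?_⟩
  · simp only [altBracket, altComp_congr hD hD' rfl f g h, altComp_congr hD' hD hN' f g h]
  · simp only [altBracket, altComp_update_add hD hD' rfl hi, altComp_update_add hD' hD hN' hi,
      smul_add]
    abel
  · simp only [altBracket, altComp_update_smul hD hD' rfl hi, altComp_update_smul hD' hD hN' hi,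
      smul_sub]
    rw [smul_comm]
  · simp only [altBracket, altComp_eq_zero hD hD' rfl hi hj hij f hf,
      altComp_eq_zero hD' hD hN' hi hj hij f hf, smul_zero, sub_zero]
  · have h := altComp_update_mul hD hD' rfl hi f a b
    have h' := altComp_update_mul hD' hD hN' hi f a b
    rw [crossSum_comm hD hD', crossSum_comm hD hD'] at h'
    have hc : ((p.factorial * q.factorial : ℕ) : ℝ) ≠ 0 :=
      Nat.cast_ne_zero.2 (mul_ne_zero (Nat.factorial_ne_zero _) (Nat.factorial_ne_zero _))
    rw [← sub_eq_zero, ← smul_eq_zero_iff_right hc, Nat.cast_smul_eq_nsmul]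
    have hs : ((-1 : A) ^ (p * q)) * (-1 : A) ^ (p * q) = 1 := by
      rw [← mul_pow]; simp
    simp only [altBracket, Nat.add_sub_cancel, nsmul_eq_mul, zsmul_eq_mul] at h h' ⊢
    push_cast at h h' ⊢
    linear_combination h - (-1 : A) ^ (p * q) * h' -
      (crossSum (p + q + 1) q D D' f i a b + crossSum (p + q + 1) q D D' f i b a) * hs
end
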